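/- arXiv:2111.02558 — 3 statements merged into one kernel-verified Lean document; each statement's English description precedes it below -/
import Mathlib

section
/- Let 1 < p < ∞. The multiplier space 𝓜_p fails to be strictly convex: for every t ∈ [0,1], the multiplier φ_t(z) = t + (1−t)z satisfies ‖φ_t‖_{𝓜_p} = 1; in particular there exist distinct φ, ψ ∈ 𝓜_p with ‖φ‖_{𝓜_p} = ‖ψ‖_{𝓜_p} = ‖(φ+ψ)/2‖_{𝓜_p} = 1. -/
open ComplexConjugate
open scoped ENNReal

noncomputable section

/-- Cauchy product of coefficient sequences (multiplication of power series). -/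
def cauchyMul (f g : ℕ → ℂ) : ℕ → ℂ :=
  fun n => ∑ k ∈ Finset.range (n + 1), f k * g (n - k)

/-- Membership in `ℓᵖ_A`: the coefficient sequence is `p`-summable (`p` finite). -/
def MemLpA (p : ℝ) (f : ℕ → ℂ) : Prop :=
  Summable fun k => ‖f k‖ ^ p

/-- The `ℓᵖ` norm of a coefficient sequence (`p` finite). -/
def pNorm (p : ℝ) (f : ℕ → ℂ) : ℝ :=
  (∑' k, ‖f k‖ ^ p) ^ (1 / p)

/-- `φ` is a multiplier of `ℓᵖ_A`. -/
def IsMultiplier (p : ℝ) (φ : ℕ → ℂ) : Prop :=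
  ∀ f : ℕ → ℂ, MemLpA p f → MemLpA p (cauchyMul φ f)

/-- The multiplier norm of `φ`, i.e. the operator norm of multiplication by `φ` on `ℓᵖ_A`. -/
def multNorm (p : ℝ) (φ : ℕ → ℂ) : ℝ :=
  sSup { x : ℝ | ∃ f : ℕ → ℂ, MemLpA p f ∧ pNorm p f ≤ 1 ∧ x = pNorm p (cauchyMul φ f) }

/-- The coefficient sequence of `t + (1 - t)z`. -/
def linearSymbol (t : ℝ) : ℕ → ℂ :=
  fun n => if n = 0 then (t : ℂ) else if n = 1 then ((1 - t : ℝ) : ℂ) else 0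

lemma cauchyMul_linearSymbol_zero (t : ℝ) (f : ℕ → ℂ) :
    cauchyMul (linearSymbol t) f 0 = t * f 0 := by
  simp [cauchyMul, linearSymbol]

lemma cauchyMul_linearSymbol_succ (t : ℝ) (f : ℕ → ℂ) (n : ℕ) :
    cauchyMul (linearSymbol t) f (n + 1) = t * f (n + 1) + ((1 - t : ℝ) : ℂ) * f n := by
  simp [cauchyMul, linearSymbol, Finset.sum_range_succ']
  ring

lemma norm_convexCombination_rpow_le {p t : ℝ} (hp : 1 ≤ p) (ht0 : 0 ≤ t) (ht1 : t ≤ 1)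
    (a b : ℂ) :
    ‖(t : ℂ) * a + ((1 - t : ℝ) : ℂ) * b‖ ^ p ≤ t * ‖a‖ ^ p + (1 - t) * ‖b‖ ^ p := by
  have h : ‖(t : ℂ) * a + ((1 - t : ℝ) : ℂ) * b‖ ≤ t * ‖a‖ + (1 - t) * ‖b‖ := by
    refine (norm_add_le _ _).trans_eq ?_
    rw [norm_mul, norm_mul, Complex.norm_of_nonneg ht0, Complex.norm_of_nonneg (sub_nonneg.2 ht1)]
  refine (Real.rpow_le_rpow (norm_nonneg _) h (by linarith)).trans ?_
  simpa using (convexOn_rpow hp).2 (norm_nonneg a) (norm_nonneg b) ht0 (sub_nonneg.2 ht1)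
    (by ring)

lemma norm_cauchyMul_linearSymbol_zero_rpow_le {p t : ℝ} (hp : 1 ≤ p) (ht0 : 0 ≤ t)
    (ht1 : t ≤ 1) (f : ℕ → ℂ) :
    ‖cauchyMul (linearSymbol t) f 0‖ ^ p ≤ t * ‖f 0‖ ^ p := by
  have h := norm_convexCombination_rpow_le hp ht0 ht1 (f 0) 0
  rwa [mul_zero, add_zero, norm_zero, Real.zero_rpow (by linarith), mul_zero, add_zero,
    ← cauchyMul_linearSymbol_zero] at h

lemma norm_cauchyMul_linearSymbol_succ_rpow_le {p t : ℝ} (hp : 1 ≤ p) (ht0 : 0 ≤ t)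
    (ht1 : t ≤ 1) (f : ℕ → ℂ) (n : ℕ) :
    ‖cauchyMul (linearSymbol t) f (n + 1)‖ ^ p
      ≤ t * ‖f (n + 1)‖ ^ p + (1 - t) * ‖f n‖ ^ p := by
  rw [cauchyMul_linearSymbol_succ]
  exact norm_convexCombination_rpow_le hp ht0 ht1 _ _

lemma isMultiplier_linearSymbol {p t : ℝ} (hp : 1 ≤ p) (ht0 : 0 ≤ t) (ht1 : t ≤ 1) :
    IsMultiplier p (linearSymbol t) := by
  intro f hf
  refine (summable_nat_add_iff 1).1 (Summable.of_nonneg_of_le (fun n => by positivity)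
    (norm_cauchyMul_linearSymbol_succ_rpow_le hp ht0 ht1 f) ?_)
  exact (((summable_nat_add_iff 1).2 hf).mul_left t).add (hf.mul_left (1 - t))

lemma pNorm_cauchyMul_linearSymbol_le {p t : ℝ} (hp : 1 ≤ p) (ht0 : 0 ≤ t) (ht1 : t ≤ 1)
    {f : ℕ → ℂ} (hf : MemLpA p f) :
    pNorm p (cauchyMul (linearSymbol t) f) ≤ pNorm p f := by
  have hg : MemLpA p (cauchyMul (linearSymbol t) f) := isMultiplier_linearSymbol hp ht0 ht1 f hf
  have hf' : Summable fun n => ‖f (n + 1)‖ ^ p := (summable_nat_add_iff 1).2 hf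
  refine Real.rpow_le_rpow (tsum_nonneg fun n => by positivity) ?_ (by positivity)
  have h : ∑' n, ‖cauchyMul (linearSymbol t) f (n + 1)‖ ^ p
      ≤ t * ∑' n, ‖f (n + 1)‖ ^ p + (1 - t) * ∑' n, ‖f n‖ ^ p := by
    rw [← tsum_mul_left, ← tsum_mul_left, ← (hf'.mul_left t).tsum_add (hf.mul_left (1 - t))]
    exact ((summable_nat_add_iff 1).2 hg).tsum_le_tsum
      (norm_cauchyMul_linearSymbol_succ_rpow_le hp ht0 ht1 f)
      ((hf'.mul_left t).add (hf.mul_left (1 - t)))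
  have h0 := norm_cauchyMul_linearSymbol_zero_rpow_le hp ht0 ht1 f
  have hsum := hf.tsum_eq_zero_add
  rw [hg.tsum_eq_zero_add]
  linear_combination h + h0 - t * hsum

/-- The normalized indicator sequence of `{0, …, N}`. -/
def normalizedIndicator (p : ℝ) (N : ℕ) : ℕ → ℂ :=
  fun n => if n ≤ N then (((N + 1 : ℝ) ^ (-(1 / p)) : ℝ) : ℂ) else 0

lemma norm_normalizedIndicator_rpow {p : ℝ} (hp : 0 < p) {N n : ℕ} (hn : n ≤ N) :
    ‖normalizedIndicator p N n‖ ^ p = (N + 1 : ℝ)⁻¹ := by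
  have hN : (0 : ℝ) ≤ N + 1 := by positivity
  rw [normalizedIndicator, if_pos hn, Complex.norm_of_nonneg (by positivity),
    ← Real.rpow_mul hN, neg_mul, one_div_mul_cancel hp.ne', Real.rpow_neg_one]

lemma hasSum_norm_normalizedIndicator_rpow {p : ℝ} (hp : 0 < p) (N : ℕ) :
    HasSum (fun n => ‖normalizedIndicator p N n‖ ^ p) 1 := by
  have h : ∑ n ∈ Finset.range (N + 1), ‖normalizedIndicator p N n‖ ^ p = 1 := by
    rw [Finset.sum_congr rfl fun n hn => norm_normalizedIndicator_rpow hp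
      (Nat.lt_succ_iff.1 (Finset.mem_range.1 hn))]
    have hN : (N + 1 : ℝ) ≠ 0 := by positivity
    simp [hN]
  rw [← h]
  refine hasSum_sum_of_ne_finset_zero fun n hn => ?_
  have hn' : ¬ n ≤ N := by simpa [Nat.lt_succ_iff] using hn
  simp [normalizedIndicator, hn', Real.zero_rpow hp.ne']

lemma le_pNorm_cauchyMul_normalizedIndicator {p t : ℝ} (hp : 1 ≤ p) (ht0 : 0 ≤ t) (ht1 : t ≤ 1)
    (N : ℕ) :
    ((N : ℝ) / (N + 1)) ^ (1 / p)
      ≤ pNorm p (cauchyMul (linearSymbol t) (normalizedIndicator p N)) := by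
  have hp0 : 0 < p := by linarith
  have hg : MemLpA p (cauchyMul (linearSymbol t) (normalizedIndicator p N)) :=
    isMultiplier_linearSymbol hp ht0 ht1 _ (hasSum_norm_normalizedIndicator_rpow hp0 N).summable
  refine Real.rpow_le_rpow (by positivity) ?_ (by positivity)
  have hterm : ∀ n ∈ Finset.range N,
      ‖cauchyMul (linearSymbol t) (normalizedIndicator p N) (n + 1)‖ ^ p = (N + 1 : ℝ)⁻¹ := by
    intro n hn
    have hn' : n + 1 ≤ N := Finset.mem_range.1 hn
    have h : cauchyMul (linearSymbol t) (normalizedIndicator p N) (n + 1)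
        = normalizedIndicator p N n := by
      have hn'' : n ≤ N := by omega
      simp only [cauchyMul_linearSymbol_succ, normalizedIndicator, if_pos hn', if_pos hn'']
      push_cast
      ring
    rw [h, norm_normalizedIndicator_rpow hp0 (by omega)]
  calc (N : ℝ) / (N + 1)
      = ∑ n ∈ Finset.range N,
          ‖cauchyMul (linearSymbol t) (normalizedIndicator p N) (n + 1)‖ ^ p := by
        rw [Finset.sum_congr rfl hterm]
        simp [div_eq_mul_inv]
    _ ≤ ∑' n, ‖cauchyMul (linearSymbol t) (normalizedIndicator p N) (n + 1)‖ ^ p :=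
        ((summable_nat_add_iff 1).2 hg).sum_le_tsum _ fun n _ => by positivity
    _ ≤ ∑' n, ‖cauchyMul (linearSymbol t) (normalizedIndicator p N) n‖ ^ p := by
        rw [hg.tsum_eq_zero_add]
        exact le_add_of_nonneg_left (by positivity)

lemma multNorm_linearSymbol {p t : ℝ} (hp : 1 ≤ p) (ht0 : 0 ≤ t) (ht1 : t ≤ 1) :
    multNorm p (linearSymbol t) = 1 := by
  have hp0 : 0 < p := by linarith
  have hmem : ∀ N : ℕ, pNorm p (cauchyMul (linearSymbol t) (normalizedIndicator p N)) ∈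
      {x : ℝ | ∃ f : ℕ → ℂ, MemLpA p f ∧ pNorm p f ≤ 1 ∧
        x = pNorm p (cauchyMul (linearSymbol t) f)} := by
    intro N
    have h := hasSum_norm_normalizedIndicator_rpow hp0 N
    exact ⟨normalizedIndicator p N, h.summable, by rw [pNorm, h.tsum_eq, Real.one_rpow], rfl⟩
  refine IsLUB.csSup_eq ⟨?_, fun b hb => ?_⟩ ⟨_, hmem 0⟩
  · rintro x ⟨f, hf, hf1, rfl⟩
    exact (pNorm_cauchyMul_linearSymbol_le hp ht0 ht1 hf).trans hf1
  · have hlim := (tendsto_natCast_div_add_atTop (1 : ℝ)).rpow_const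
      (p := 1 / p) (Or.inl one_ne_zero)
    rw [Real.one_rpow] at hlim
    exact le_of_tendsto' hlim fun N =>
      (le_pNorm_cauchyMul_normalizedIndicator hp ht0 ht1 N).trans (hb (hmem N))

/-- `𝓜_p` is not strictly convex: every `φ_t(z) = t + (1 - t)z`, `t ∈ [0,1]`, has multiplier
norm `1`; in particular there are distinct multipliers `φ, ψ` of norm one whose midpoint also
has norm one. -/
theorem multiplier_space_not_strictly_convex (p : ℝ) (hp : 1 < p) :
    (∀ t : ℝ, 0 ≤ t → t ≤ 1 →
      IsMultiplier p (fun n => if n = 0 then (t : ℂ) else if n = 1 then ((1 - t : ℝ) : ℂ) else 0) ∧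
      multNorm p (fun n => if n = 0 then (t : ℂ) else if n = 1 then ((1 - t : ℝ) : ℂ) else 0) = 1) ∧
    ∃ φ ψ : ℕ → ℂ, IsMultiplier p φ ∧ IsMultiplier p ψ ∧ φ ≠ ψ ∧
      multNorm p φ = 1 ∧ multNorm p ψ = 1 ∧
      multNorm p (fun n => (φ n + ψ n) / 2) = 1 := by
  have key : ∀ t : ℝ, 0 ≤ t → t ≤ 1 →
      IsMultiplier p (linearSymbol t) ∧ multNorm p (linearSymbol t) = 1 := fun t ht0 ht1 =>
    ⟨isMultiplier_linearSymbol hp.le ht0 ht1, multNorm_linearSymbol hp.le ht0 ht1⟩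
  have h0 := key 0 le_rfl zero_le_one
  have h1 := key 1 zero_le_one le_rfl
  refine ⟨key, linearSymbol 1, linearSymbol 0, h1.1, h0.1, fun h => ?_, h1.2, h0.2, ?_⟩
  · simpa [linearSymbol] using congrFun h 0
  · have hmid : (fun n => (linearSymbol 1 n + linearSymbol 0 n) / 2) = linearSymbol (1 / 2) := by
      funext n
      simp only [linearSymbol]
      split_ifs <;> norm_num
    rw [hmid]
    exact (key (1 / 2) (by norm_num) (by norm_num)).2
end
end

section
/- Let 1 < p < ∞. The space 𝓜_p fails the upper weak parallelogram property for every constant C > 0 and exponent r > 1: for every C > 0 and r > 1 there exist x, y ∈ 𝓜_p (of the form x = (1+sz)/2, y = (1−sz)/2 for suitable s > 0) with ‖x+y‖_{𝓜_p}^r + C‖x−y‖_{𝓜_p}^r < 2^{r−1}(‖x‖_{𝓜_p}^r + ‖y‖_{𝓜_p}^r). -/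
open ComplexConjugate
open scoped ENNReal

noncomputable section

/-- The coefficient sequence of the affine function `a + b z`. -/
def affineSeq (a b : ℂ) : ℕ → ℂ :=
  fun n => if n = 0 then a else if n = 1 then b else 0

lemma cauchyMul_affineSeq_zero (a b : ℂ) (f : ℕ → ℂ) :
    cauchyMul (affineSeq a b) f 0 = a * f 0 := by
  simp [cauchyMul, affineSeq]

lemma cauchyMul_affineSeq_succ (a b : ℂ) (f : ℕ → ℂ) (n : ℕ) :
    cauchyMul (affineSeq a b) f (n + 1) = a * f (n + 1) + b * f n := by
  simp [cauchyMul, affineSeq, Finset.sum_range_succ']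
  ring

lemma pNorm_nonneg (p : ℝ) (f : ℕ → ℂ) : 0 ≤ pNorm p f :=
  Real.rpow_nonneg (tsum_nonneg fun _ => by positivity) _

/-- Minkowski's inequality for multiplication by `a + b z`. -/
lemma memLpA_and_pNorm_cauchyMul_affineSeq_le {p : ℝ} (hp : 1 < p) (a b : ℂ) {f : ℕ → ℂ}
    (hf : MemLpA p f) :
    MemLpA p (cauchyMul (affineSeq a b) f) ∧
      pNorm p (cauchyMul (affineSeq a b) f) ≤ (‖a‖ + ‖b‖) * pNorm p f := by
  have hp0 : 0 < p := by linarith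
  set g : ℕ → ℝ := fun n => Nat.casesOn n 0 (fun m => ‖f m‖) with hg
  have hg0 : ∀ n, 0 ≤ g n := by
    intro n
    cases n <;> simp [hg]
  have hgs : Summable fun n => g n ^ p := by
    rw [← summable_nat_add_iff 1]
    exact hf
  have hgt : ∑' n, g n ^ p = ∑' n, ‖f n‖ ^ p := by
    rw [hgs.tsum_eq_zero_add]
    simp [hg, Real.zero_rpow hp0.ne']
  have hnorm : ∀ (c : ℝ) (u : ℕ → ℝ), 0 ≤ c → (∀ n, 0 ≤ u n) →
      (∑' n, (c * u n) ^ p) ^ (1 / p) = c * (∑' n, u n ^ p) ^ (1 / p) := by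
    intro c u hc hu
    have : ∀ n, (c * u n) ^ p = c ^ p * u n ^ p := fun n => Real.mul_rpow hc (hu n)
    simp_rw [this]
    rw [tsum_mul_left, Real.mul_rpow (by positivity)
      (tsum_nonneg fun n => Real.rpow_nonneg (hu n) _), ← Real.rpow_mul hc,
      mul_one_div_cancel hp0.ne', Real.rpow_one]
  have hs : ∀ (c : ℝ) (u : ℕ → ℝ), 0 ≤ c → (∀ n, 0 ≤ u n) → (Summable fun n => u n ^ p) →
      Summable fun n => (c * u n) ^ p := by
    intro c u hc hu h
    simpa only [fun n => Real.mul_rpow (z := p) hc (hu n)] using h.mul_left (c ^ p)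
  obtain ⟨hsum, hle⟩ := Real.Lp_add_le_tsum_of_nonneg hp.le
    (f := fun n => ‖a‖ * ‖f n‖) (g := fun n => ‖b‖ * g n)
    (fun n => by positivity) (fun n => mul_nonneg (norm_nonneg _) (hg0 n))
    (hs _ _ (norm_nonneg _) (fun n => norm_nonneg _) hf) (hs _ _ (norm_nonneg _) hg0 hgs)
  have hpt : ∀ n, ‖cauchyMul (affineSeq a b) f n‖ ^ p ≤ (‖a‖ * ‖f n‖ + ‖b‖ * g n) ^ p := by
    intro n
    refine Real.rpow_le_rpow (norm_nonneg _) ?_ hp0.le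
    cases n with
    | zero => simp [cauchyMul_affineSeq_zero, hg]
    | succ n =>
      rw [cauchyMul_affineSeq_succ]
      simpa [hg] using norm_add_le (a * f (n + 1)) (b * f n)
  have hmem : MemLpA p (cauchyMul (affineSeq a b) f) :=
    Summable.of_nonneg_of_le (fun n => by positivity) hpt hsum
  refine ⟨hmem, ?_⟩
  calc pNorm p (cauchyMul (affineSeq a b) f)
      ≤ (∑' n, (‖a‖ * ‖f n‖ + ‖b‖ * g n) ^ p) ^ (1 / p) :=
        Real.rpow_le_rpow (tsum_nonneg fun n => by positivity)
          (hmem.tsum_le_tsum hpt hsum) (by positivity)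
    _ ≤ _ := hle
    _ = (‖a‖ + ‖b‖) * pNorm p f := by
        rw [hnorm _ _ (norm_nonneg _) (fun n => norm_nonneg _), hnorm _ _ (norm_nonneg _) hg0, hgt,
          pNorm, add_mul]

lemma isMultiplier_affineSeq {p : ℝ} (hp : 1 < p) (a b : ℂ) : IsMultiplier p (affineSeq a b) :=
  fun _ hf => (memLpA_and_pNorm_cauchyMul_affineSeq_le hp a b hf).1

lemma pNorm_cauchyMul_affineSeq_le_of_pNorm_le_one {p : ℝ} (hp : 1 < p) (a b : ℂ) {f : ℕ → ℂ}
    (hf : MemLpA p f) (hf1 : pNorm p f ≤ 1) :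
    pNorm p (cauchyMul (affineSeq a b) f) ≤ ‖a‖ + ‖b‖ :=
  (memLpA_and_pNorm_cauchyMul_affineSeq_le hp a b hf).2.trans
    (mul_le_of_le_one_right (by positivity) hf1)

lemma multNorm_nonneg (p : ℝ) (φ : ℕ → ℂ) : 0 ≤ multNorm p φ := by
  refine Real.sSup_nonneg ?_
  rintro _ ⟨f, -, -, rfl⟩
  exact pNorm_nonneg _ _

lemma multNorm_affineSeq_le {p : ℝ} (hp : 1 < p) (a b : ℂ) :
    multNorm p (affineSeq a b) ≤ ‖a‖ + ‖b‖ := by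
  refine Real.sSup_le ?_ (by positivity)
  rintro _ ⟨f, hf, hf1, rfl⟩
  exact pNorm_cauchyMul_affineSeq_le_of_pNorm_le_one hp a b hf hf1

lemma pNorm_le_multNorm_affineSeq {p : ℝ} (hp : 1 < p) (a b : ℂ) {f : ℕ → ℂ}
    (hf : MemLpA p f) (hf1 : pNorm p f ≤ 1) :
    pNorm p (cauchyMul (affineSeq a b) f) ≤ multNorm p (affineSeq a b) := by
  refine le_csSup ⟨‖a‖ + ‖b‖, ?_⟩ ⟨f, hf, hf1, rfl⟩
  rintro _ ⟨g, hg, hg1, rfl⟩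
  exact pNorm_cauchyMul_affineSeq_le_of_pNorm_le_one hp a b hg hg1

/-- Testing multiplication by `a + ε t z` on the normalised section `∑_{k ≤ M} (ε z)^k`. -/
lemma mul_le_multNorm_affineSeq {p : ℝ} (hp : 1 < p) {a t : ℝ} (ha : 0 ≤ a) (ht : 0 ≤ t) {ε : ℂ}
    (hε : ‖ε‖ = 1) (M : ℕ) :
    ((M : ℝ) / (M + 1)) ^ (1 / p) * (a + t) ≤ multNorm p (affineSeq a (ε * t)) := by
  have hp0 : 0 < p := by linarith
  set c : ℝ := (1 / ((M : ℝ) + 1)) ^ (1 / p) with hc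
  have hc0 : 0 ≤ c := by positivity
  have hcp : c ^ p = 1 / ((M : ℝ) + 1) := by
    rw [hc, ← Real.rpow_mul (by positivity), one_div_mul_cancel hp0.ne', Real.rpow_one]
  set f : ℕ → ℂ := fun k => if k < M + 1 then ε ^ k * c else 0 with hf
  have hfn : ∀ k, ‖f k‖ ^ p = if k < M + 1 then 1 / ((M : ℝ) + 1) else 0 := by
    intro k
    by_cases hk : k < M + 1
    · simp only [hf, hk, if_true, norm_mul, norm_pow, hε, one_pow, one_mul, Complex.norm_real,
        Real.norm_of_nonneg hc0, hcp]
    · simp only [hf, hk, if_false, norm_zero, Real.zero_rpow hp0.ne']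
  have hsupp : ∀ k ∉ Finset.range (M + 1), ‖f k‖ ^ p = 0 := by
    intro k hk
    rw [hfn, if_neg (by simpa using hk)]
  have hmem : MemLpA p f := summable_of_ne_finset_zero hsupp
  have hf1 : pNorm p f = 1 := by
    have : ∑' k, ‖f k‖ ^ p = 1 := by
      rw [tsum_eq_sum hsupp, Finset.sum_congr rfl fun k hk => by
        rw [hfn, if_pos (Finset.mem_range.1 hk)]]
      have : (M : ℝ) + 1 ≠ 0 := by positivity
      simp [this]
    rw [pNorm, this, Real.one_rpow]
  refine le_trans ?_ (pNorm_le_multNorm_affineSeq hp _ _ hmem hf1.le)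
  have hgmem := isMultiplier_affineSeq hp a (ε * t) f hmem
  have hval : ∀ n ∈ Finset.range M,
      ‖cauchyMul (affineSeq a (ε * t)) f (n + 1)‖ ^ p = (a + t) ^ p * (1 / ((M : ℝ) + 1)) := by
    intro n hn
    have hn' := Finset.mem_range.1 hn
    have : cauchyMul (affineSeq a (ε * t)) f (n + 1) = ε ^ (n + 1) * ((a + t : ℝ) * (c : ℝ)) := by
      rw [cauchyMul_affineSeq_succ]
      simp only [hf, show n + 1 < M + 1 by omega, show n < M + 1 by omega, if_true]
      push_cast
      ring
    rw [this, norm_mul, norm_mul, norm_pow, hε, one_pow, one_mul, Complex.norm_real,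
      Complex.norm_real, Real.norm_of_nonneg hc0, Real.norm_of_nonneg (by positivity),
      Real.mul_rpow (by positivity) hc0, hcp]
  have hlow : (M : ℝ) / (M + 1) * (a + t) ^ p ≤
      ∑' n, ‖cauchyMul (affineSeq a (ε * t)) f n‖ ^ p := by
    rw [Summable.tsum_eq_zero_add hgmem]
    have h1 := ((summable_nat_add_iff 1).2 hgmem).sum_le_tsum (Finset.range M)
      fun n _ => by positivity
    rw [Finset.sum_congr rfl hval] at h1
    simp only [Finset.sum_const, Finset.card_range, nsmul_eq_mul] at h1
    have h0 : 0 ≤ ‖cauchyMul (affineSeq a (ε * t)) f 0‖ ^ p := by positivity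
    calc (M : ℝ) / (M + 1) * (a + t) ^ p = M * ((a + t) ^ p * (1 / ((M : ℝ) + 1))) := by ring
      _ ≤ _ := h1
      _ ≤ _ := le_add_of_nonneg_left h0
  calc ((M : ℝ) / (M + 1)) ^ (1 / p) * (a + t)
      = ((M : ℝ) / (M + 1) * (a + t) ^ p) ^ (1 / p) := by
        rw [Real.mul_rpow (by positivity) (by positivity), ← Real.rpow_mul (by positivity) p,
          mul_one_div_cancel hp0.ne', Real.rpow_one]
    _ ≤ _ := Real.rpow_le_rpow (by positivity) hlow (by positivity)

lemma add_le_multNorm_affineSeq {p : ℝ} (hp : 1 < p) {a t : ℝ} (ha : 0 ≤ a) (ht : 0 ≤ t) {ε : ℂ}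
    (hε : ‖ε‖ = 1) : a + t ≤ multNorm p (affineSeq a (ε * t)) := by
  have hlim : Filter.Tendsto (fun M : ℕ => ((M : ℝ) / (M + 1)) ^ (1 / p) * (a + t)) Filter.atTop
      (nhds ((1 : ℝ) ^ (1 / p) * (a + t))) :=
    ((tendsto_natCast_div_add_atTop (1 : ℝ)).rpow_const (Or.inl one_ne_zero)).mul_const _
  rw [Real.one_rpow, one_mul] at hlim
  exact le_of_tendsto' hlim (mul_le_multNorm_affineSeq hp ha ht hε)

/-- `𝓜_p` fails the upper weak parallelogram property for every `C > 0` and `r > 1`. -/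
theorem multiplier_space_fails_UWP (p : ℝ) (hp : 1 < p) (C r : ℝ) (hC : 0 < C) (hr : 1 < r) :
    ∃ x y : ℕ → ℂ, IsMultiplier p x ∧ IsMultiplier p y ∧
      (∃ s : ℝ, 0 < s ∧
        x = (fun n => if n = 0 then (1 : ℂ) / 2 else if n = 1 then (s : ℂ) / 2 else 0) ∧
        y = (fun n => if n = 0 then (1 : ℂ) / 2 else if n = 1 then -(s : ℂ) / 2 else 0)) ∧
      multNorm p (fun n => x n + y n) ^ r + C * multNorm p (fun n => x n - y n) ^ r
        < 2 ^ (r - 1) * (multNorm p x ^ r + multNorm p y ^ r) := by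
  have hr0 : 0 < r := by linarith
  obtain ⟨s, hs, hCs⟩ : ∃ s : ℝ, 0 < s ∧ C * s ^ r = r * s := by
    refine ⟨(r / C) ^ (1 / (r - 1)), by positivity, ?_⟩
    set s : ℝ := (r / C) ^ (1 / (r - 1)) with hs
    have hs0 : 0 < s := by positivity
    have h1 : s ^ (r - 1) = r / C := by
      rw [hs, ← Real.rpow_mul (by positivity), one_div_mul_cancel (by linarith), Real.rpow_one]
    have h2 : s ^ r = s ^ (r - 1) * s := by
      rw [← Real.rpow_add_one hs0.ne', sub_add_cancel]
    rw [h2, h1]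
    field_simp
  refine ⟨affineSeq (1 / 2) (s / 2), affineSeq (1 / 2) (-s / 2), isMultiplier_affineSeq hp _ _,
    isMultiplier_affineSeq hp _ _, ⟨s, hs, rfl, rfl⟩, ?_⟩
  have hadd : (fun n => affineSeq (1 / 2) (s / 2) n + affineSeq (1 / 2) (-s / 2) n) =
      affineSeq 1 0 := by
    funext n
    simp only [affineSeq]
    split_ifs <;> ring
  have hsub : (fun n => affineSeq (1 / 2) (s / 2) n - affineSeq (1 / 2) (-s / 2) n) =
      affineSeq 0 s := by
    funext n
    simp only [affineSeq]
    split_ifs <;> ring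
  have hx : (1 + s) / 2 ≤ multNorm p (affineSeq (1 / 2) (s / 2)) := by
    have h := add_le_multNorm_affineSeq hp (a := 1 / 2) (t := s / 2) (by positivity)
      (by positivity) (ε := 1) (by simp)
    rw [← add_div] at h
    convert h using 3 <;> push_cast <;> ring
  have hy : (1 + s) / 2 ≤ multNorm p (affineSeq (1 / 2) (-s / 2)) := by
    have h := add_le_multNorm_affineSeq hp (a := 1 / 2) (t := s / 2) (by positivity)
      (by positivity) (ε := -1) (by simp)
    rw [← add_div] at h
    convert h using 3 <;> push_cast <;> ring
  have h1 : multNorm p (affineSeq 1 0) ≤ 1 := by simpa using multNorm_affineSeq_le hp 1 0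
  have h2 : multNorm p (affineSeq 0 s) ≤ s := by
    simpa [abs_of_pos hs] using multNorm_affineSeq_le hp 0 s
  rw [hadd, hsub]
  calc multNorm p (affineSeq 1 0) ^ r + C * multNorm p (affineSeq 0 s) ^ r
      ≤ 1 ^ r + C * s ^ r := by
        gcongr <;> exact multNorm_nonneg _ _
    _ = 1 + r * s := by rw [Real.one_rpow, hCs]
    _ < (1 + s) ^ r := one_add_mul_self_lt_rpow_one_add (by linarith) hs.ne' hr
    _ = 2 ^ (r - 1) * (((1 + s) / 2) ^ r + ((1 + s) / 2) ^ r) := by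
        rw [Real.div_rpow (by positivity) (by positivity), Real.rpow_sub_one two_ne_zero]
        field_simp
        ring
    _ ≤ _ := by gcongr
end
end

section
/- Let 1 < p < ∞. In the multiplier space 𝓜_p, the constant function 1 is Birkhoff–James orthogonal to z: for every complex number c, ‖1 + cz‖_{𝓜_p} ≥ ‖1‖_{𝓜_p} = 1. -/
open ComplexConjugate
open scoped ENNReal

noncomputable section

theorem cauchyMul_one_left (f : ℕ → ℂ) :
    cauchyMul (fun n => if n = 0 then (1 : ℂ) else 0) f = f := by
  funext n
  simp [cauchyMul]

theorem cauchyMul_one_right (φ : ℕ → ℂ) :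
    cauchyMul φ (fun n => if n = 0 then (1 : ℂ) else 0) = φ := by
  funext n
  rw [cauchyMul, Finset.sum_eq_single_of_mem n (by simp)]
  · simp
  · intro k hk hkn
    have : n - k ≠ 0 := by
      have := Finset.mem_range.mp hk
      omega
    simp [this]

theorem cauchyMul_linear_zero (c : ℂ) (f : ℕ → ℂ) :
    cauchyMul (fun n => if n = 0 then (1 : ℂ) else if n = 1 then c else 0) f 0 = f 0 := by
  simp [cauchyMul]

theorem cauchyMul_linear_succ (c : ℂ) (f : ℕ → ℂ) (n : ℕ) :
    cauchyMul (fun n => if n = 0 then (1 : ℂ) else if n = 1 then c else 0) f (n + 1) =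
      f (n + 1) + c * f n := by
  rw [cauchyMul, Finset.sum_range_succ', Finset.sum_range_succ']
  simp [add_comm]

theorem hasSum_one_rpow {p : ℝ} (hp : 0 < p) :
    HasSum (fun k : ℕ => ‖(if k = 0 then (1 : ℂ) else 0)‖ ^ p) 1 := by
  convert hasSum_ite_eq (0 : ℕ) (1 : ℝ) using 2 with k
  split_ifs <;> simp [Real.zero_rpow hp.ne']

theorem pNorm_one {p : ℝ} (hp : 0 < p) :
    pNorm p (fun n => if n = 0 then (1 : ℂ) else 0) = 1 := by
  rw [pNorm, (hasSum_one_rpow hp).tsum_eq, Real.one_rpow]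

theorem tsum_rpow_le_one_of_pNorm_le_one {p : ℝ} (hp : 0 < p) {f : ℕ → ℂ}
    (hf : pNorm p f ≤ 1) : ∑' k, ‖f k‖ ^ p ≤ 1 := by
  by_contra! h
  exact absurd hf (not_le.mpr (Real.one_lt_rpow h (by positivity)))

theorem norm_le_pNorm {p : ℝ} (hp : 0 < p) {f : ℕ → ℂ} (hf : MemLpA p f) (n : ℕ) :
    ‖f n‖ ≤ pNorm p f := by
  have h : ‖f n‖ ^ p ≤ ∑' k, ‖f k‖ ^ p :=
    hf.le_tsum n fun k _ => by positivity
  have h' := Real.rpow_le_rpow (by positivity) h (one_div_nonneg.mpr hp.le)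
  rwa [one_div, Real.rpow_rpow_inv (norm_nonneg _) hp.ne', ← one_div] at h'

/-- Multiplication by `1 + cz` is bounded on `ℓᵖ_A`. -/
theorem cauchyMul_linear_bound {p : ℝ} (hp : 1 < p) (c : ℂ) {f : ℕ → ℂ}
    (hf : MemLpA p f) (hf1 : pNorm p f ≤ 1) :
    pNorm p (cauchyMul (fun n => if n = 0 then (1 : ℂ) else if n = 1 then c else 0) f) ≤
      (1 + 2 ^ (p - 1) * (1 + ‖c‖ ^ p)) ^ (1 / p) := by
  have hp0 : 0 < p := by linarith
  have hS := tsum_rpow_le_one_of_pNorm_le_one hp0 hf1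
  set g := cauchyMul (fun n => if n = 0 then (1 : ℂ) else if n = 1 then c else 0) f with hg
  have hf' : Summable fun n => ‖f (n + 1)‖ ^ p :=
    (summable_nat_add_iff (f := fun k => ‖f k‖ ^ p) 1).mpr hf
  have hsplit := Summable.tsum_eq_zero_add hf
  have h0 : ‖f 0‖ ^ p ≥ 0 := by positivity
  have ht : 0 ≤ ∑' n, ‖f (n + 1)‖ ^ p := tsum_nonneg fun _ => by positivity
  have hle : ∀ n, ‖g (n + 1)‖ ^ p ≤
      2 ^ (p - 1) * (‖f (n + 1)‖ ^ p + ‖c‖ ^ p * ‖f n‖ ^ p) := by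
    intro n
    rw [hg, cauchyMul_linear_succ, ← Real.mul_rpow (norm_nonneg _) (norm_nonneg _), ← norm_mul]
    exact (Real.rpow_le_rpow (norm_nonneg _) (norm_add_le _ _) hp0.le).trans
      (mod_cast NNReal.rpow_add_le_mul_rpow_add_rpow ‖f (n + 1)‖₊ ‖c * f n‖₊ hp.le)
  have hdom : Summable fun n => 2 ^ (p - 1) * (‖f (n + 1)‖ ^ p + ‖c‖ ^ p * ‖f n‖ ^ p) :=
    (hf'.add (hf.mul_left _)).mul_left _
  have hg' : Summable fun n => ‖g (n + 1)‖ ^ p :=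
    hdom.of_nonneg_of_le (fun _ => by positivity) hle
  have hgs : Summable fun n => ‖g n‖ ^ p :=
    (summable_nat_add_iff (f := fun k => ‖g k‖ ^ p) 1).mp hg'
  have htail : ∑' n, ‖g (n + 1)‖ ^ p ≤ 2 ^ (p - 1) * (1 + ‖c‖ ^ p) := by
    refine (hg'.tsum_le_tsum hle hdom).trans ?_
    rw [tsum_mul_left, hf'.tsum_add (hf.mul_left _), tsum_mul_left]
    have : ‖c‖ ^ p * ∑' n, ‖f n‖ ^ p ≤ ‖c‖ ^ p := mul_le_of_le_one_right (by positivity) hS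
    gcongr
    linarith
  refine Real.rpow_le_rpow (tsum_nonneg fun _ => by positivity) ?_ (by positivity)
  rw [hgs.tsum_eq_zero_add, hg, cauchyMul_linear_zero, ← hg]
  linarith

theorem multNorm_one {p : ℝ} (hp : 0 < p) :
    multNorm p (fun n => if n = 0 then (1 : ℂ) else 0) = 1 := by
  refine IsGreatest.csSup_eq ⟨⟨_, (hasSum_one_rpow hp).summable, (pNorm_one hp).le, ?_⟩, ?_⟩
  · rw [cauchyMul_one_left, pNorm_one hp]
  · rintro x ⟨f, -, hf, rfl⟩
    rwa [cauchyMul_one_left]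

theorem memLpA_linear {p : ℝ} (hp : 0 < p) (c : ℂ) :
    MemLpA p (fun n => if n = 0 then (1 : ℂ) else if n = 1 then c else 0) := by
  refine summable_of_ne_finset_zero (s := Finset.range 2) fun n hn => ?_
  have : n ≠ 0 ∧ n ≠ 1 := by
    simp only [Finset.mem_range] at hn
    omega
  simp [this.1, this.2, Real.zero_rpow hp.ne']

/-- In `𝓜_p`, the constant `1` is Birkhoff–James orthogonal to `z`:
`‖1 + cz‖_{𝓜_p} ≥ ‖1‖_{𝓜_p} = 1` for every `c ∈ ℂ`. -/
theorem one_birkhoff_james_orthogonal_z (p : ℝ) (hp : 1 < p) :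
    multNorm p (fun n => if n = 0 then (1 : ℂ) else 0) = 1 ∧
    ∀ c : ℂ, multNorm p (fun n => if n = 0 then (1 : ℂ) else if n = 1 then c else 0)
      ≥ multNorm p (fun n => if n = 0 then (1 : ℂ) else 0) := by
  have hp0 : 0 < p := by linarith
  refine ⟨multNorm_one hp0, fun c => ?_⟩
  rw [multNorm_one hp0, ge_iff_le]
  have hnorm := norm_le_pNorm hp0 (memLpA_linear hp0 c) 0
  rw [if_pos rfl, norm_one] at hnorm
  refine hnorm.trans (le_csSup ⟨(1 + 2 ^ (p - 1) * (1 + ‖c‖ ^ p)) ^ (1 / p), ?_⟩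
    ⟨_, (hasSum_one_rpow hp0).summable, (pNorm_one hp0).le, by rw [cauchyMul_one_right]⟩)
  rintro x ⟨f, hf, hf1, rfl⟩
  exact cauchyMul_linear_bound hp c hf hf1
end
end
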